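/- arXiv:2408.06757 — 2 statements merged into one kernel-verified Lean document; each statement's English description precedes it below -/
import Mathlib

section
/- Let Λ be a countable index set, let g_λ ∈ L¹(ℝⁿ) ∩ L²(ℝⁿ) for each λ ∈ Λ, and let 0 < C₁ ≤ C₂ < ∞. Then the system {T_s^θ ǧ_λ : s ∈ ℝⁿ, λ ∈ Λ} is a semi-discrete frame for L²(ℝⁿ) with bounds C₁, C₂, i.e. C₁‖f‖² ≤ Σ_{λ∈Λ} ∫_{ℝⁿ} |⟨T_s^θ ǧ_λ, f⟩_{L²}|² ds ≤ C₂‖f‖² for all f ∈ L²(ℝⁿ), if and only if C₁/|sin θ|ⁿ ≤ Σ_{λ∈Λ} |F_θ(g_λ)(ω)|² ≤ C₂/|sin θ|ⁿ for almost every ω ∈ ℝⁿ. -/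
noncomputable section

open MeasureTheory Complex
open scoped InnerProductSpace ENNReal

abbrev Rn (n : ℕ) : Type := EuclideanSpace ℝ (Fin n)

variable {n : ℕ}

/-- θ-translation: `T_s^θ f (t) = e^{-2πi (s·(t-s)) cot θ} f (t-s)`. -/
def thetaTrans (θ : ℝ) (s : Rn n) (f : Rn n → ℂ) : Rn n → ℂ :=
  fun t => Complex.exp (((-2 * Real.pi * ⟪s, t - s⟫_ℝ * Real.cot θ : ℝ) : ℂ) * Complex.I) * f (t - s)

/-- Reflection `ǧ (x) = g (-x)`. -/
def reflFun (f : Rn n → ℂ) : Rn n → ℂ := fun x => f (-x)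

/-- Fractional Fourier transform (integral form, for integrable `f`). -/
def frft (θ : ℝ) (f : Rn n → ℂ) : Rn n → ℂ :=
  fun ω => ((|Real.sin θ| ^ (-(n : ℝ) / 2) : ℝ) : ℂ) *
    ∫ t, f t * Complex.exp
      (((Real.pi * ((⟪t, t⟫_ℝ + ⟪ω, ω⟫_ℝ) * Real.cot θ - 2 * ⟪ω, t⟫_ℝ / Real.sin θ) : ℝ) : ℂ) *
        Complex.I)

/-- `L²` inner product (linear in the first argument). -/
def L2inner (f g : Rn n → ℂ) : ℂ := ∫ t, f t * (starRingEnd ℂ) (g t)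

/-- Squared `L²` norm, as an extended nonnegative real. -/
def lNormSq (f : Rn n → ℂ) : ℝ≥0∞ := ∫⁻ t, (‖f t‖₊ : ℝ≥0∞) ^ 2

open FourierTransform SchwartzMap

section Plancherel

variable {V : Type*} [NormedAddCommGroup V] [InnerProductSpace ℝ V] [FiniteDimensional ℝ V]
  [MeasurableSpace V] [BorelSpace V]

lemma continuous_fourier_of_integrable {P : V → ℂ} (hP : Integrable P) : Continuous (𝓕 P) :=
  VectorFourier.fourierIntegral_continuous (L := innerₗ V) Real.continuous_fourierChar
    continuous_inner hP

/-- On `L¹ ∩ L²` the `L²` Fourier transform is given by the Fourier integral. -/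
lemma coeFn_fourier_toLp_ae_eq {P : V → ℂ} (h1 : Integrable P) (h2 : MemLp P 2) :
    ((𝓕 (h2.toLp P) : Lp ℂ 2 (volume : Measure V)) : V → ℂ) =ᵐ[volume] 𝓕 P := by
  apply ae_eq_of_integral_contDiff_smul_eq
  · exact (Lp.memLp _).locallyIntegrable (by norm_num)
  · exact (continuous_fourier_of_integrable h1).locallyIntegrable
  · intro φ φ_smooth φ_cpt
    have hφ₁ : HasCompactSupport (Complex.ofRealCLM ∘ φ) := φ_cpt.comp_left rfl
    have hφ₂ : ContDiff ℝ (⊤ : ℕ∞) (Complex.ofRealCLM ∘ φ) := by fun_prop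
    let Φ : 𝓢(V, ℂ) := hφ₁.toSchwartzMap hφ₂
    calc ∫ x, φ x • (𝓕 (h2.toLp P) : Lp ℂ 2 (volume : Measure V)) x
        = Lp.toTemperedDistribution (𝓕 (h2.toLp P) : Lp ℂ 2 (volume : Measure V)) Φ := by
          simp [Φ, Lp.toTemperedDistribution_apply]
      _ = ∫ x, 𝓕 Φ x • (h2.toLp P) x := by
          rw [← Lp.fourier_toTemperedDistribution_eq, TemperedDistribution.fourier_apply,
            Lp.toTemperedDistribution_apply]
      _ = ∫ x, 𝓕 (Φ : V → ℂ) x • P x := by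
          refine integral_congr_ae ?_
          filter_upwards [h2.coeFn_toLp] with x hx
          rw [hx, SchwartzMap.fourier_coe]
      _ = ∫ x, Φ x • 𝓕 P x := by
          simpa using! VectorFourier.integral_fourierIntegral_smul_eq_flip (L := innerₗ V)
            Real.continuous_fourierChar continuous_inner Φ.integrable h1
      _ = ∫ x, φ x • 𝓕 P x := by simp [Φ]

lemma lintegral_nnnorm_sq_eq_eLpNorm_sq (P : V → ℂ) :
    ∫⁻ x, (‖P x‖₊ : ℝ≥0∞) ^ 2 = eLpNorm P 2 volume ^ 2 := by
  rw [eLpNorm_eq_lintegral_rpow_enorm_toReal two_ne_zero ENNReal.ofNat_ne_top,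
    ← ENNReal.rpow_natCast, ← ENNReal.rpow_mul]
  simp [enorm_eq_nnnorm]

lemma eLpNorm_fourier_eq (F : Lp ℂ 2 (volume : Measure V)) :
    eLpNorm (𝓕 F : Lp ℂ 2 (volume : Measure V)) 2 volume = eLpNorm F 2 volume := by
  rw [← ENNReal.toReal_eq_toReal_iff' (Lp.eLpNorm_ne_top _) (Lp.eLpNorm_ne_top _),
    ← Lp.norm_def, ← Lp.norm_def, Lp.norm_fourier_eq]

lemma lintegral_fourier_toLp_eq {P : V → ℂ} (h2 : MemLp P 2) :
    ∫⁻ x, (‖(𝓕 (h2.toLp P) : Lp ℂ 2 (volume : Measure V)) x‖₊ : ℝ≥0∞) ^ 2 =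
      ∫⁻ x, (‖P x‖₊ : ℝ≥0∞) ^ 2 := by
  rw [lintegral_nnnorm_sq_eq_eLpNorm_sq, lintegral_nnnorm_sq_eq_eLpNorm_sq, eLpNorm_fourier_eq,
    eLpNorm_congr_ae h2.coeFn_toLp]

/-- Plancherel's theorem for the Fourier integral on `L¹ ∩ L²`. -/
lemma lintegral_fourier_eq {P : V → ℂ} (h1 : Integrable P) (h2 : MemLp P 2) :
    ∫⁻ x, (‖𝓕 P x‖₊ : ℝ≥0∞) ^ 2 = ∫⁻ x, (‖P x‖₊ : ℝ≥0∞) ^ 2 := by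
  rw [← lintegral_fourier_toLp_eq h2]
  refine lintegral_congr_ae ?_
  filter_upwards [coeFn_fourier_toLp_ae_eq h1 h2] with x hx
  rw [hx]

lemma memLp_fourier {P : V → ℂ} (h1 : Integrable P) (h2 : MemLp P 2) :
    MemLp (𝓕 P) 2 (volume : Measure V) :=
  (memLp_congr_ae (coeFn_fourier_toLp_ae_eq h1 h2)).1 (Lp.memLp _)

lemma fourier_conj_comp_sub_left (G : V → ℂ) (s ξ : V) :
    𝓕 (fun t => (starRingEnd ℂ) (G (s - t))) ξ =
      (starRingEnd ℂ) (Complex.exp (↑(2 * Real.pi * ⟪ξ, s⟫_ℝ) * Complex.I) * 𝓕 G ξ) := by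
  rw [Real.fourier_eq', Real.fourier_eq', ← integral_const_mul, ← integral_conj,
    ← integral_sub_left_eq_self _ volume s]
  congr 1
  ext t
  simp only [sub_sub_cancel, smul_eq_mul, map_mul, ← mul_assoc, ← Complex.exp_conj,
    ← Complex.exp_add]
  congr 2
  rw [inner_sub_left, real_inner_comm s ξ]
  simp only [map_add, map_mul, Complex.conj_ofReal, Complex.conj_I]
  push_cast
  ring

/-- Convolution theorem for an `L¹ ∩ L²` function and an `L²` function. -/
lemma integral_comp_sub_mul_eq_fourier {G H : V → ℂ} (h1 : Integrable G) (h2 : MemLp G 2)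
    (hH : MemLp H 2) (s : V) :
    ∫ t, G (s - t) * H t =
      𝓕 (fun ξ => 𝓕 G ξ * (𝓕 (hH.toLp H) : Lp ℂ 2 (volume : Measure V)) ξ) (-s) := by
  have hK1 : Integrable (fun t => (starRingEnd ℂ) (G (s - t))) :=
    (LinearIsometryEquiv.integrable_comp_iff Complex.conjLIE).2 (h1.comp_sub_left s)
  have hK2 : MemLp (fun t => (starRingEnd ℂ) (G (s - t))) 2 :=
    (h2.comp_measurePreserving (Measure.measurePreserving_sub_left volume s)).star
  have key := Lp.inner_fourier_eq (hK2.toLp _) (hH.toLp H)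
  rw [L2.inner_def, L2.inner_def] at key
  calc ∫ t, G (s - t) * H t = _ := by
        refine integral_congr_ae ?_
        filter_upwards [hK2.coeFn_toLp, hH.coeFn_toLp] with t h h'
        rw [h, h', RCLike.inner_apply, RCLike.conj_conj, mul_comm]
    _ = _ := key.symm
    _ = _ := by
        rw [Real.fourier_eq']
        refine integral_congr_ae ?_
        filter_upwards [coeFn_fourier_toLp_ae_eq hK1 hK2] with ξ h
        rw [h, fourier_conj_comp_sub_left, RCLike.inner_apply, RCLike.conj_conj, inner_neg_right,
          smul_eq_mul, mul_comm, mul_assoc]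
        congr 3
        push_cast
        ring

/-- The `L²` norm of the convolution of an `L¹ ∩ L²` function with an `L²` function. -/
lemma lintegral_convolution_sq {G H : V → ℂ} (h1 : Integrable G) (h2 : MemLp G 2)
    (hH : MemLp H 2) :
    ∫⁻ s, (‖∫ t, G (s - t) * H t‖₊ : ℝ≥0∞) ^ 2 =
      ∫⁻ ξ, (‖𝓕 G ξ‖₊ : ℝ≥0∞) ^ 2 *
        (‖(𝓕 (hH.toLp H) : Lp ℂ 2 (volume : Measure V)) ξ‖₊ : ℝ≥0∞) ^ 2 := by
  have hP : MemLp ((𝓕 (hH.toLp H) : Lp ℂ 2 (volume : Measure V)) : V → ℂ) 2 := Lp.memLp _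
  have hQ1 : Integrable (fun ξ => 𝓕 G ξ * (𝓕 (hH.toLp H) : Lp ℂ 2 (volume : Measure V)) ξ) :=
    (memLp_fourier h1 h2).integrable_mul hP
  have hQ2 : MemLp (fun ξ => 𝓕 G ξ * (𝓕 (hH.toLp H) : Lp ℂ 2 (volume : Measure V)) ξ) 2 := by
    refine hP.of_le_mul (c := ∫ v, ‖G v‖) hQ1.aestronglyMeasurable (Filter.Eventually.of_forall ?_)
    intro ξ
    rw [norm_mul]
    gcongr
    exact VectorFourier.norm_fourierIntegral_le_integral_norm _ _ _ _ _
  simp_rw [integral_comp_sub_mul_eq_fourier h1 h2 hH]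
  rw [lintegral_neg_eq_self (μ := volume) (fun s => (‖𝓕 (fun ξ => 𝓕 G ξ *
    (𝓕 (hH.toLp H) : Lp ℂ 2 (volume : Measure V)) ξ) s‖₊ : ℝ≥0∞) ^ 2),
    lintegral_fourier_eq hQ1 hQ2]
  simp [mul_pow]

end Plancherel

/-- The quadratic phase `e^{πi (t·t) cot θ}`. -/
def chirp (θ : ℝ) (t : Rn n) : ℂ :=
  Complex.exp (((Real.pi * ⟪t, t⟫_ℝ * Real.cot θ : ℝ) : ℂ) * Complex.I)

lemma norm_chirp (θ : ℝ) (t : Rn n) : ‖chirp θ t‖ = 1 :=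
  Complex.norm_exp_ofReal_mul_I _

lemma continuous_chirp (θ : ℝ) : Continuous (chirp θ : Rn n → ℂ) := by
  unfold chirp
  fun_prop

lemma MeasureTheory.MemLp.chirp_mul {p : ℝ≥0∞} {f : Rn n → ℂ} (θ : ℝ) (hf : MemLp f p) :
    MemLp (fun t => chirp θ t * f t) p :=
  hf.of_le ((continuous_chirp θ).aestronglyMeasurable.mul hf.aestronglyMeasurable)
    (Filter.Eventually.of_forall fun t => by simp [norm_chirp])

lemma MeasureTheory.Integrable.chirp_mul {f : Rn n → ℂ} (θ : ℝ) (hf : Integrable f) :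
    Integrable fun t => chirp θ t * f t :=
  memLp_one_iff_integrable.1 ((memLp_one_iff_integrable.2 hf).chirp_mul θ)

lemma norm_frft_sq (θ : ℝ) (g : Rn n → ℂ) (ω : Rn n) :
    ‖frft θ g ω‖ ^ 2 =
      (|Real.sin θ| ^ n)⁻¹ * ‖𝓕 (fun t => chirp θ t * g t) ((Real.sin θ)⁻¹ • ω)‖ ^ 2 := by
  have hint : ∫ t, g t * Complex.exp
      (((Real.pi * ((⟪t, t⟫_ℝ + ⟪ω, ω⟫_ℝ) * Real.cot θ - 2 * ⟪ω, t⟫_ℝ / Real.sin θ) : ℝ) : ℂ) *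
        Complex.I) = chirp θ ω * 𝓕 (fun t => chirp θ t * g t) ((Real.sin θ)⁻¹ • ω) := by
    rw [Real.fourier_eq', ← integral_const_mul]
    congr 1
    ext t
    rw [smul_eq_mul, chirp, chirp, mul_comm (g t), ← mul_assoc, ← mul_assoc, ← Complex.exp_add,
      ← Complex.exp_add, inner_smul_right, real_inner_comm ω t]
    congr 2
    push_cast
    ring
  have hpow : (|Real.sin θ| ^ (-(n : ℝ) / 2)) ^ 2 = (|Real.sin θ| ^ n)⁻¹ := by
    rw [← Real.rpow_natCast, ← Real.rpow_mul (abs_nonneg _), ← Real.rpow_natCast,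
      ← Real.rpow_neg (abs_nonneg _)]
    congr 1
    push_cast
    ring
  rw [frft, hint, norm_mul, norm_mul, norm_chirp, one_mul, mul_pow, ← hpow, Complex.norm_real,
    Real.norm_eq_abs, sq_abs]

lemma nnnorm_L2inner_thetaTrans (θ : ℝ) (g f : Rn n → ℂ) (s : Rn n) :
    ‖L2inner (thetaTrans θ s (reflFun g)) f‖₊ =
      ‖∫ t, (chirp θ (s - t) * g (s - t)) * (starRingEnd ℂ) (chirp θ t * f t)‖₊ := by
  have h : L2inner (thetaTrans θ s (reflFun g)) f = chirp θ s *
      ∫ t, (chirp θ (s - t) * g (s - t)) * (starRingEnd ℂ) (chirp θ t * f t) := by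
    rw [L2inner, ← integral_const_mul]
    congr 1
    ext t
    have hphase : Complex.exp (((-2 * Real.pi * ⟪s, t - s⟫_ℝ * Real.cot θ : ℝ) : ℂ) * Complex.I) =
        chirp θ s * chirp θ (s - t) * (starRingEnd ℂ) (chirp θ t) := by
      simp only [chirp, ← Complex.exp_conj, ← Complex.exp_add, map_mul, Complex.conj_ofReal,
        Complex.conj_I]
      congr 1
      rw [inner_sub_sub_self, inner_sub_right, real_inner_comm t s]
      push_cast
      ring
    rw [thetaTrans, reflFun, hphase, neg_sub, map_mul]
    ring
  ext
  rw [h, coe_nnnorm, norm_mul, norm_chirp, one_mul, coe_nnnorm]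

lemma memLp_conj_chirp_mul {f : Rn n → ℂ} (θ : ℝ) (hf : MemLp f 2) :
    MemLp (fun t => (starRingEnd ℂ) (chirp θ t * f t)) 2 :=
  (hf.chirp_mul θ).star

/-- Every `L²` function is, almost everywhere, the Fourier transform of the conjugate of a chirped
`L²` function. -/
lemma exists_fourier_conj_chirp_mul_eq (θ : ℝ) (P : Lp ℂ 2 (volume : Measure (Rn n))) :
    ∃ (f : Rn n → ℂ) (hf : MemLp f 2), 𝓕 ((memLp_conj_chirp_mul θ hf).toLp _) = P := by
  have hQ : MemLp ((𝓕⁻ P : Lp ℂ 2 (volume : Measure (Rn n))) : Rn n → ℂ) 2 := Lp.memLp _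
  refine ⟨_, memLp_conj_chirp_mul θ hQ, ?_⟩
  refine (congrArg 𝓕 ?_).trans (FourierTransform.fourier_fourierInv_eq P)
  refine Lp.ext ((MemLp.coeFn_toLp _).trans (Filter.Eventually.of_forall fun t => ?_))
  simp only [map_mul, Complex.conj_conj, ← mul_assoc]
  rw [mul_comm ((starRingEnd ℂ) _), Complex.mul_conj']
  simp [norm_chirp]

lemma tsum_lintegral_L2inner_eq {Λ : Type*} [Countable Λ] (θ : ℝ) {g : Λ → Rn n → ℂ}
    (hg1 : ∀ l, Integrable (g l)) (hg2 : ∀ l, MemLp (g l) 2) {f : Rn n → ℂ} (hf : MemLp f 2) :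
    ∑' l, ∫⁻ s : Rn n, (‖L2inner (thetaTrans θ s (reflFun (g l))) f‖₊ : ℝ≥0∞) ^ 2 =
      ∫⁻ ξ, (∑' l, (‖𝓕 (fun t => chirp θ t * g l t) ξ‖₊ : ℝ≥0∞) ^ 2) *
        (‖(𝓕 ((memLp_conj_chirp_mul θ hf).toLp _) : Lp ℂ 2 (volume : Measure (Rn n))) ξ‖₊ :
          ℝ≥0∞) ^ 2 := by
  simp_rw [← ENNReal.tsum_mul_right, nnnorm_L2inner_thetaTrans]
  rw [lintegral_tsum]
  · congr 1
    ext l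
    exact lintegral_convolution_sq ((hg1 l).chirp_mul θ) ((hg2 l).chirp_mul θ)
      (memLp_conj_chirp_mul θ hf)
  · intro l
    have := (continuous_fourier_of_integrable ((hg1 l).chirp_mul θ)).measurable
    have := (Lp.stronglyMeasurable
      (𝓕 ((memLp_conj_chirp_mul θ hf).toLp _) : Lp ℂ 2 (volume : Measure (Rn n)))).measurable
    fun_prop

lemma lNormSq_eq_lintegral_fourier (θ : ℝ) {f : Rn n → ℂ} (hf : MemLp f 2) :
    lNormSq f = ∫⁻ ξ, (‖(𝓕 ((memLp_conj_chirp_mul θ hf).toLp _) :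
      Lp ℂ 2 (volume : Measure (Rn n))) ξ‖₊ : ℝ≥0∞) ^ 2 := by
  rw [lintegral_fourier_toLp_eq, lNormSq]
  congr 1
  ext t
  have h : ‖(starRingEnd ℂ) (chirp θ t * f t)‖₊ = ‖f t‖₊ := by
    ext
    simp [norm_chirp]
  rw [h]

/-- A multiplier is bounded below and above on `L²` exactly when its symbol is. -/
lemma forall_Lp_lintegral_mul_bounds_iff {α : Type*} [MeasurableSpace α] {μ : Measure α}
    [SigmaFinite μ] {m : α → ℝ≥0∞} (hm : Measurable m) (A B : ℝ≥0∞) :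
    (∀ P : Lp ℂ 2 μ,
      A * ∫⁻ x, (‖P x‖₊ : ℝ≥0∞) ^ 2 ∂μ ≤ ∫⁻ x, m x * (‖P x‖₊ : ℝ≥0∞) ^ 2 ∂μ ∧
      ∫⁻ x, m x * (‖P x‖₊ : ℝ≥0∞) ^ 2 ∂μ ≤ B * ∫⁻ x, (‖P x‖₊ : ℝ≥0∞) ^ 2 ∂μ) ↔
      ∀ᵐ x ∂μ, A ≤ m x ∧ m x ≤ B := by
  have hmeas : ∀ P : Lp ℂ 2 μ, Measurable fun x => (‖P x‖₊ : ℝ≥0∞) ^ 2 := fun P => by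
    have := (Lp.stronglyMeasurable P).measurable
    fun_prop
  constructor
  · intro h
    have hset : ∀ s, MeasurableSet s → μ s < ∞ → A * μ s ≤ ∫⁻ x in s, m x ∂μ ∧
        ∫⁻ x in s, m x ∂μ ≤ B * μ s := by
      intro s hs hμs
      have hind : (fun x => (‖indicatorConstLp 2 hs hμs.ne (1 : ℂ) x‖₊ : ℝ≥0∞) ^ 2) =ᵐ[μ]
          s.indicator 1 := by
        filter_upwards [indicatorConstLp_coeFn (p := 2) (hs := hs) (hμs := hμs.ne) (c := (1 : ℂ))]
          with x hx
        rw [hx]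
        by_cases hxs : x ∈ s <;> simp [hxs]
      have hmind : (fun x => m x * (‖indicatorConstLp 2 hs hμs.ne (1 : ℂ) x‖₊ : ℝ≥0∞) ^ 2) =ᵐ[μ]
          s.indicator m := by
        filter_upwards [hind] with x hx
        rw [hx]
        by_cases hxs : x ∈ s <;> simp [hxs]
      have key := h (indicatorConstLp 2 hs hμs.ne 1)
      rwa [lintegral_congr_ae hind, lintegral_congr_ae hmind, lintegral_indicator_one hs,
        lintegral_indicator hs] at key
    refine Filter.Eventually.and ?_ ?_
    · refine ae_le_of_forall_setLIntegral_le_of_sigmaFinite (f := fun _ => A) measurable_const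
        fun s hs hμs => ?_
      rw [setLIntegral_const]
      exact (hset s hs hμs).1
    · refine ae_le_of_forall_setLIntegral_le_of_sigmaFinite (g := fun _ => B) hm
        fun s hs hμs => ?_
      rw [setLIntegral_const]
      exact (hset s hs hμs).2
  · intro h P
    rw [← lintegral_const_mul _ (hmeas P), ← lintegral_const_mul _ (hmeas P)]
    constructor <;> refine lintegral_mono_ae (h.mono fun x hx => ?_)
    · exact mul_le_mul_left hx.1 _
    · exact mul_le_mul_left hx.2 _

/-- For a positive lower bound, two-sided bounds of a real series of nonnegative terms (with value
zero when divergent) agree with those of the extended nonnegative series. -/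
lemma tsum_bounds_iff_ennreal {Λ : Type*} {a : Λ → ℝ} (ha : ∀ l, 0 ≤ a l) {A B : ℝ} (hA : 0 < A)
    (hB : 0 ≤ B) :
    (A ≤ ∑' l, a l ∧ ∑' l, a l ≤ B) ↔
      ENNReal.ofReal A ≤ ∑' l, ENNReal.ofReal (a l) ∧
        ∑' l, ENNReal.ofReal (a l) ≤ ENNReal.ofReal B := by
  by_cases hs : Summable a
  · rw [← ENNReal.ofReal_tsum_of_nonneg ha hs, ENNReal.ofReal_le_ofReal_iff (tsum_nonneg ha),
      ENNReal.ofReal_le_ofReal_iff hB]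
  · constructor
    · intro h
      rw [tsum_eq_zero_of_not_summable hs] at h
      exact absurd h.1 hA.not_ge
    · intro h
      refine absurd ?_ hs
      have := ENNReal.summable_toReal (h.2.trans_lt ENNReal.ofReal_lt_top).ne
      simpa only [ENNReal.toReal_ofReal (ha _)] using this

lemma ae_comp_smul_iff {V : Type*} [NormedAddCommGroup V] [NormedSpace ℝ V]
    [FiniteDimensional ℝ V] [MeasurableSpace V] [BorelSpace V] {μ : Measure V}
    [μ.IsAddHaarMeasure] {r : ℝ} (hr : r ≠ 0) {p : V → Prop} :
    (∀ᵐ x ∂μ, p (r • x)) ↔ ∀ᵐ x ∂μ, p x := by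
  refine ⟨fun h => ?_, fun h => (Measure.quasiMeasurePreserving_smul μ hr).ae h⟩
  have := (Measure.quasiMeasurePreserving_smul μ (inv_ne_zero hr)).ae h
  simpa [smul_smul, hr] using this

/-- The semi-discrete system `{T_s^θ ǧ_λ : s ∈ ℝⁿ, λ ∈ Λ}` is a
semi-discrete frame for `L²(ℝⁿ)` with bounds `C₁, C₂` iff
`C₁/|sin θ|ⁿ ≤ Σ_λ |F_θ(g_λ)(ω)|² ≤ C₂/|sin θ|ⁿ` for a.e. `ω ∈ ℝⁿ`. -/
theorem statement1 (n : ℕ) (hn : 1 ≤ n) (θ : ℝ) (hθ : Real.sin θ ≠ 0)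
    {Λ : Type} [Countable Λ] (g : Λ → Rn n → ℂ)
    (hg1 : ∀ l, Integrable (g l) (volume : Measure (Rn n)))
    (hg2 : ∀ l, MemLp (g l) 2 (volume : Measure (Rn n)))
    (C₁ C₂ : ℝ) (hC₁ : 0 < C₁) (hC₁₂ : C₁ ≤ C₂) :
    (∀ f : Rn n → ℂ, MemLp f 2 (volume : Measure (Rn n)) →
        ENNReal.ofReal C₁ * lNormSq f ≤
            (∑' l : Λ, ∫⁻ s : Rn n,
              (‖L2inner (thetaTrans θ s (reflFun (g l))) f‖₊ : ℝ≥0∞) ^ 2) ∧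
          (∑' l : Λ, ∫⁻ s : Rn n,
              (‖L2inner (thetaTrans θ s (reflFun (g l))) f‖₊ : ℝ≥0∞) ^ 2) ≤
            ENNReal.ofReal C₂ * lNormSq f) ↔
      (∀ᵐ ω : Rn n ∂(volume : Measure (Rn n)),
        C₁ / |Real.sin θ| ^ n ≤ (∑' l : Λ, ‖frft θ (g l) ω‖ ^ 2) ∧
          (∑' l : Λ, ‖frft θ (g l) ω‖ ^ 2) ≤ C₂ / |Real.sin θ| ^ n) := by
  have hsin : 0 < |Real.sin θ| ^ n := by positivity
  let m : Rn n → ℝ≥0∞ := fun ξ =>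
    ∑' l, (‖𝓕 (fun t => chirp θ t * g l t) ξ‖₊ : ℝ≥0∞) ^ 2
  have hm : Measurable m := by
    refine Measurable.tsum fun l => ?_
    have := (continuous_fourier_of_integrable ((hg1 l).chirp_mul θ)).measurable
    fun_prop
  have hω : ∀ ω : Rn n, (C₁ / |Real.sin θ| ^ n ≤ (∑' l : Λ, ‖frft θ (g l) ω‖ ^ 2) ∧
      (∑' l : Λ, ‖frft θ (g l) ω‖ ^ 2) ≤ C₂ / |Real.sin θ| ^ n) ↔
      (ENNReal.ofReal C₁ ≤ m ((Real.sin θ)⁻¹ • ω) ∧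
        m ((Real.sin θ)⁻¹ • ω) ≤ ENNReal.ofReal C₂) := by
    intro ω
    have hm_ofReal : m ((Real.sin θ)⁻¹ • ω) = ∑' l, ENNReal.ofReal
        (‖𝓕 (fun t => chirp θ t * g l t) ((Real.sin θ)⁻¹ • ω)‖ ^ 2) := by
      refine tsum_congr fun l => ?_
      rw [ENNReal.ofReal_pow (norm_nonneg _), ofReal_norm, enorm_eq_nnnorm]
    rw [hm_ofReal, ← tsum_bounds_iff_ennreal (fun _ => sq_nonneg _) hC₁ (hC₁.le.trans hC₁₂)]
    simp_rw [norm_frft_sq]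
    rw [tsum_mul_left, div_eq_inv_mul, div_eq_inv_mul, mul_le_mul_iff_right₀ (inv_pos.2 hsin),
      mul_le_mul_iff_right₀ (inv_pos.2 hsin)]
  simp_rw [hω]
  rw [ae_comp_smul_iff (inv_ne_zero hθ)
      (p := fun ξ => ENNReal.ofReal C₁ ≤ m ξ ∧ m ξ ≤ ENNReal.ofReal C₂),
    ← forall_Lp_lintegral_mul_bounds_iff hm]
  constructor
  · intro h P
    obtain ⟨f, hf, rfl⟩ := exists_fourier_conj_chirp_mul_eq θ P
    have := h f hf
    rwa [tsum_lintegral_L2inner_eq θ hg1 hg2 hf, lNormSq_eq_lintegral_fourier θ hf] at this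
  · intro h f hf
    rw [tsum_lintegral_L2inner_eq θ hg1 hg2 hf, lNormSq_eq_lintegral_fourier θ hf]
    exact h _
end
end

section
/- Let f, g ∈ L²(ℝⁿ) and t ∈ ℝⁿ. Then T_t^θ(f ⋆_θ g)(x) = ((T_t^θ f) ⋆_θ g)(x) for every x ∈ ℝⁿ, where both θ-convolutions are given by absolutely convergent integrals. -/
noncomputable section

open MeasureTheory Complex
open scoped InnerProductSpace ENNReal

variable {n : ℕ}

/-- θ-convolution `(f ⋆_θ g)(x) = |sin θ|^{-n/2} ∫ f(s) T_s^θ g (x) ds`. -/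
def thetaConv (θ : ℝ) (f g : Rn n → ℂ) : Rn n → ℂ :=
  fun x => ((|Real.sin θ| ^ (-(n : ℝ) / 2) : ℝ) : ℂ) * ∫ s, f s * thetaTrans θ s g x

/-- Multiplication by a continuous unimodular phase preserves membership in `Lᵖ`. -/
theorem memLp_exp_mul_I_mul {p : ℝ≥0∞} {φ : Rn n → ℝ} (hφ : Continuous φ) {h : Rn n → ℂ}
    (hh : MemLp h p (volume : Measure (Rn n))) :
    MemLp (fun s => Complex.exp ((φ s : ℂ) * Complex.I) * h s) p (volume : Measure (Rn n)) := by
  have hc : Continuous fun s => Complex.exp ((φ s : ℂ) * Complex.I) := by fun_prop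
  refine hh.of_le (hc.aestronglyMeasurable.mul hh.aestronglyMeasurable) (.of_forall fun s => ?_)
  rw [norm_mul, Complex.norm_exp_ofReal_mul_I, one_mul]

/-- The θ-translate of an `Lᵖ` function is in `Lᵖ`. -/
theorem memLp_thetaTrans {p : ℝ≥0∞} (θ : ℝ) (t : Rn n) {f : Rn n → ℂ}
    (hf : MemLp f p (volume : Measure (Rn n))) :
    MemLp (thetaTrans θ t f) p (volume : Measure (Rn n)) :=
  memLp_exp_mul_I_mul (φ := fun s => -2 * Real.pi * ⟪t, s - t⟫_ℝ * Real.cot θ) (by fun_prop)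
    (hf.comp_measurePreserving (measurePreserving_sub_right volume t))

/-- For fixed `x`, the map `s ↦ T_s^θ g (x)` is in `Lᵖ` whenever `g` is. -/
theorem memLp_thetaTrans_apply {p : ℝ≥0∞} (θ : ℝ) (x : Rn n) {g : Rn n → ℂ}
    (hg : MemLp g p (volume : Measure (Rn n))) :
    MemLp (fun s => thetaTrans θ s g x) p (volume : Measure (Rn n)) :=
  memLp_exp_mul_I_mul (φ := fun s => -2 * Real.pi * ⟪s, x - s⟫_ℝ * Real.cot θ) (by fun_prop)
    (hg.comp_measurePreserving (volume.measurePreserving_sub_left x))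

/-- The cocycle identity behind the covariance of the θ-convolution under θ-translations. -/
theorem thetaTrans_add_mul_thetaTrans_add (θ : ℝ) (f g : Rn n → ℂ) (t x s : Rn n) :
    thetaTrans θ t f (s + t) * thetaTrans θ (s + t) g x =
      Complex.exp (((-2 * Real.pi * ⟪t, x - t⟫_ℝ * Real.cot θ : ℝ) : ℂ) * Complex.I) *
        (f s * thetaTrans θ s g (x - t)) := by
  have hphase : -2 * Real.pi * ⟪t, s⟫_ℝ * Real.cot θ +
      -2 * Real.pi * ⟪s + t, x - t - s⟫_ℝ * Real.cot θ =
      -2 * Real.pi * ⟪t, x - t⟫_ℝ * Real.cot θ +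
        -2 * Real.pi * ⟪s, x - t - s⟫_ℝ * Real.cot θ := by
    simp only [inner_add_left, inner_sub_right]
    ring
  have hexp := congrArg (fun r : ℝ => Complex.exp ((r : ℂ) * Complex.I)) hphase
  simp only [Complex.ofReal_add, add_mul, Complex.exp_add] at hexp
  have hx : x - (s + t) = x - t - s := by abel
  simp only [thetaTrans, add_sub_cancel_right, hx]
  linear_combination f s * g (x - t - s) * hexp

/-- θ-translations commute with the θ-convolution, for arbitrary functions. -/
theorem thetaTrans_thetaConv (θ : ℝ) (f g : Rn n → ℂ) (t : Rn n) :
    thetaTrans θ t (thetaConv θ f g) = thetaConv θ (thetaTrans θ t f) g := by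
  funext x
  have hint : ∫ s, thetaTrans θ t f s * thetaTrans θ s g x =
      Complex.exp (((-2 * Real.pi * ⟪t, x - t⟫_ℝ * Real.cot θ : ℝ) : ℂ) * Complex.I) *
        ∫ s, f s * thetaTrans θ s g (x - t) := by
    rw [← integral_add_right_eq_self _ t, ← integral_const_mul]
    simp only [thetaTrans_add_mul_thetaTrans_add]
  rw [thetaConv, hint, thetaTrans, thetaConv]
  ring

/-- For `f, g ∈ L²(ℝⁿ)` and `t ∈ ℝⁿ`,
`T_t^θ (f ⋆_θ g)(x) = ((T_t^θ f) ⋆_θ g)(x)` for every `x`, both θ-convolutions being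
given by absolutely convergent integrals. -/
theorem statement3 (n : ℕ) (hn : 1 ≤ n) (θ : ℝ) (hθ : Real.sin θ ≠ 0)
    (f g : Rn n → ℂ) (hf : MemLp f 2 (volume : Measure (Rn n)))
    (hg : MemLp g 2 (volume : Measure (Rn n))) (t : Rn n) :
    ∀ x : Rn n,
      Integrable (fun s => f s * thetaTrans θ s g x) (volume : Measure (Rn n)) ∧
      Integrable (fun s => thetaTrans θ t f s * thetaTrans θ s g x) (volume : Measure (Rn n)) ∧
      thetaTrans θ t (thetaConv θ f g) x = thetaConv θ (thetaTrans θ t f) g x := by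
  exact fun x => ⟨hf.integrable_mul (memLp_thetaTrans_apply θ x hg),
    (memLp_thetaTrans θ t hf).integrable_mul (memLp_thetaTrans_apply θ x hg),
    congrFun (thetaTrans_thetaConv θ f g t) x⟩
end
end
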